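/- arXiv:1906.02491 — 2 statements merged into one kernel-verified Lean document; each statement's English description precedes it below -/
import Mathlib

section
/- For every step 1 ≤ i ≤ L° of the greedy cover and every nonempty candidate set C ∈ F, the number of elements of C newly covered at step i times the smallest weight in C is bounded by the greedy weighted gain at step i: (u_{i−1}(C) − u_i(C)) · min_{m∈C} q(m) ≤ α_i(C°_i) − α_{i−1}(C°_i). -/
open Finset

variable {α : Type*} [DecidableEq α]

/-- `greedyU Cg i` is the union `U_i = C°_1 ∪ ⋯ ∪ C°_i` of the first `i` greedy sets
(`U_0 = ∅`). -/
def greedyU (Cg : ℕ → Finset α) (i : ℕ) : Finset α :=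
  (Finset.Icc 1 i).biUnion Cg

/-- `uncov Cg i C = u_i(C)`, the number of elements of `C` uncovered after step `i`. -/
def uncov (Cg : ℕ → Finset α) (i : ℕ) (C : Finset α) : ℕ :=
  (C \ greedyU Cg i).card

/-- `covWt q Cg i C = α_i(C)`, the covered weight of `C` after step `i`. -/
def covWt (q : α → ℝ) (Cg : ℕ → Finset α) (i : ℕ) (C : Finset α) : ℝ :=
  ∑ m ∈ C ∩ greedyU Cg i, q m

theorem greedyU_mono (Cg : ℕ → Finset α) : Monotone (greedyU Cg) := fun _ _ h =>
  Finset.biUnion_subset_biUnion_of_subset_left Cg (Finset.Icc_subset_Icc_right h)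

/-- The greedy gain `α_i(C°_i) − α_{i−1}(C°_i)` is the weight of the elements of `C°_i` not covered
before step `i`. -/
theorem covWt_gain (q : α → ℝ) (Cg : ℕ → Finset α) {i : ℕ} (hi : 1 ≤ i) :
    covWt q Cg i (Cg i) - covWt q Cg (i - 1) (Cg i) =
      ∑ m ∈ Cg i \ greedyU Cg (i - 1), q m := by
  have hcov : Cg i ∩ greedyU Cg i = Cg i :=
    Finset.inter_eq_left.mpr
      (Finset.subset_biUnion_of_mem Cg (Finset.mem_Icc.mpr ⟨hi, le_rfl⟩))
  rw [covWt, covWt, hcov, sub_eq_iff_eq_add, add_comm, Finset.sum_inter_add_sum_sdiff]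

/-- At every greedy step `i` and for every nonempty candidate `C ∈ F`,
`(u_{i−1}(C) − u_i(C)) · min_{m∈C} q m ≤ α_i(C°_i) − α_{i−1}(C°_i)`. -/
theorem newly_covered_times_min_le_greedy_gain
    (M : Finset α) (q : α → ℝ) (F : Finset (Finset α))
    (hF : F.Nonempty) (hFsub : ∀ C ∈ F, C ⊆ M) (hq : ∀ m ∈ M, 0 < q m)
    (Lg : ℕ) (Cg : ℕ → Finset α)
    (hCgF : ∀ i, 1 ≤ i → i ≤ Lg → Cg i ∈ F)
    (hgreedy : ∀ i, 1 ≤ i → i ≤ Lg → ∀ C ∈ F,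
      ∑ m ∈ C \ greedyU Cg (i - 1), q m ≤ ∑ m ∈ Cg i \ greedyU Cg (i - 1), q m) :
    ∀ i, 1 ≤ i → i ≤ Lg → ∀ C ∈ F, ∀ (hCne : C.Nonempty),
      ((uncov Cg (i - 1) C : ℝ) - (uncov Cg i C : ℝ)) * C.inf' hCne q ≤
        covWt q Cg i (Cg i) - covWt q Cg (i - 1) (Cg i) := by
  intro i hi hiL C hC hCne
  have hmono : greedyU Cg (i - 1) ⊆ greedyU Cg i :=
    greedyU_mono Cg (Nat.sub_le i 1)
  have hsub : C \ greedyU Cg i ⊆ C \ greedyU Cg (i - 1) :=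
    Finset.sdiff_subset_sdiff subset_rfl hmono
  rw [covWt_gain q Cg hi]
  refine le_trans ?_ (hgreedy i hi hiL C hC)
  have hcard : (uncov Cg (i - 1) C : ℝ) - (uncov Cg i C : ℝ) =
      (((C \ greedyU Cg (i - 1)) \ (C \ greedyU Cg i)).card : ℝ) := by
    rw [Finset.cast_card_sdiff hsub]
    rfl
  rw [hcard, ← nsmul_eq_mul]
  refine (Finset.card_nsmul_le_sum _ q _ fun m hm => ?_).trans
    (Finset.sum_le_sum_of_subset_of_nonneg Finset.sdiff_subset fun m hm _ => ?_)
  · exact Finset.inf'_le q (Finset.mem_sdiff.mp (Finset.mem_sdiff.mp hm).1).1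
  · exact (hq m (hFsub C hC (Finset.mem_sdiff.mp hm).1)).le
end

section
/- Fix l with 1 ≤ l ≤ L*, and suppose m ∈ C*_l ∩ M° is first covered at step i of the greedy cover. Then its price satisfies c_m ≤ (u_{i−1}(C°_i) − u_i(C°_i)) / ((u_{i−1}(C*_l ∩ M°) − u_i(C*_l ∩ M°)) · min_{m'∈C*_l∩M°} q(m')), where the denominator is positive because m itself is an element of C*_l ∩ M° that becomes covered at step i. (This follows because the greedy choice satisfies α_i(C°_i) − α_{i−1}(C°_i) ≥ α_i(C*_l) − α_{i−1}(C*_l) ≥ (u_{i−1}(C*_l ∩ M°) − u_i(C*_l ∩ M°)) · min_{m'∈C*_l∩M°} q(m').) -/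
open Finset

variable {α : Type*} [DecidableEq α]

theorem subset_greedyU (Cg : ℕ → Finset α) {i : ℕ} (hi : 1 ≤ i) : Cg i ⊆ greedyU Cg i :=
  subset_biUnion_of_mem Cg (mem_Icc.2 ⟨hi, le_rfl⟩)

theorem uncov_sub_uncov (Cg : ℕ → Finset α) {i j : ℕ} (hij : i ≤ j) (C : Finset α) :
    (uncov Cg i C : ℝ) - uncov Cg j C = ((C ∩ greedyU Cg j) \ greedyU Cg i).card := by
  have hsub : C \ greedyU Cg j ⊆ C \ greedyU Cg i :=
    sdiff_subset_sdiff Subset.rfl (greedyU_mono Cg hij)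
  have heq : (C ∩ greedyU Cg j) \ greedyU Cg i = (C \ greedyU Cg i) \ (C \ greedyU Cg j) := by
    ext x
    simp only [mem_sdiff, mem_inter]
    tauto
  rw [heq, cast_card_sdiff hsub, uncov, uncov]

theorem covWt_sub_covWt (q : α → ℝ) (Cg : ℕ → Finset α) {i j : ℕ} (hij : i ≤ j)
    (C : Finset α) :
    covWt q Cg j C - covWt q Cg i C = ∑ m ∈ (C ∩ greedyU Cg j) \ greedyU Cg i, q m := by
  have hsub : C ∩ greedyU Cg i ⊆ C ∩ greedyU Cg j :=
    inter_subset_inter Subset.rfl (greedyU_mono Cg hij)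
  have heq : (C ∩ greedyU Cg j) \ greedyU Cg i = (C ∩ greedyU Cg j) \ (C ∩ greedyU Cg i) := by
    ext x
    simp only [mem_sdiff, mem_inter]
    tauto
  rw [heq, covWt, covWt, sub_eq_iff_eq_add, sum_sdiff hsub]

/-- If `m ∈ C*_l ∩ M°` is first covered at step `i` of the greedy cover,
then its price satisfies
`c_m ≤ (u_{i−1}(C°_i) − u_i(C°_i)) /
  ((u_{i−1}(C*_l ∩ M°) − u_i(C*_l ∩ M°)) · min_{m'∈C*_l∩M°} q m')`. -/
theorem price_upper_bound_via_optimal_set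
    (M : Finset α) (q : α → ℝ) (F : Finset (Finset α))
    (hF : F.Nonempty) (hFsub : ∀ C ∈ F, C ⊆ M) (hq : ∀ m ∈ M, 0 < q m)
    (Lg : ℕ) (Cg : ℕ → Finset α)
    (hCgF : ∀ i, 1 ≤ i → i ≤ Lg → Cg i ∈ F)
    (hgreedy : ∀ i, 1 ≤ i → i ≤ Lg → ∀ C ∈ F,
      ∑ m ∈ C \ greedyU Cg (i - 1), q m ≤ ∑ m ∈ Cg i \ greedyU Cg (i - 1), q m)
    (Lopt : ℕ) (Copt : ℕ → Finset α)
    (hCoptF : ∀ l, 1 ≤ l → l ≤ Lopt → Copt l ∈ F)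
    (l : ℕ) (hl1 : 1 ≤ l) (hlL : l ≤ Lopt)
    (m : α) (hmD : m ∈ Copt l ∩ greedyU Cg Lg)
    (i : ℕ) (hi1 : 1 ≤ i) (hiL : i ≤ Lg)
    (hmC : m ∈ Cg i) (hmU : m ∈ greedyU Cg i) (hmU' : m ∉ greedyU Cg (i - 1)) :
    ((uncov Cg (i - 1) (Cg i) : ℝ) - (uncov Cg i (Cg i) : ℝ)) /
        (covWt q Cg i (Cg i) - covWt q Cg (i - 1) (Cg i)) ≤
      ((uncov Cg (i - 1) (Cg i) : ℝ) - (uncov Cg i (Cg i) : ℝ)) /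
        (((uncov Cg (i - 1) (Copt l ∩ greedyU Cg Lg) : ℝ) -
            (uncov Cg i (Copt l ∩ greedyU Cg Lg) : ℝ)) *
          (Copt l ∩ greedyU Cg Lg).inf' ⟨m, hmD⟩ q) := by
  have hle : i - 1 ≤ i := Nat.sub_le i 1
  have hqopt : ∀ x ∈ Copt l, 0 < q x := fun x hx => hq x (hFsub _ (hCoptF l hl1 hlL) hx)
  rw [uncov_sub_uncov Cg hle, uncov_sub_uncov Cg hle, covWt_sub_covWt q Cg hle,
    inter_eq_left.2 (subset_greedyU Cg hi1)]
  set D := Copt l ∩ greedyU Cg Lg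
  set N := (D ∩ greedyU Cg i) \ greedyU Cg (i - 1)
  have hND : N ⊆ D := sdiff_subset.trans inter_subset_left
  have hmN : m ∈ N := mem_sdiff.2 ⟨mem_inter.2 ⟨hmD, hmU⟩, hmU'⟩
  have hmin : 0 < D.inf' ⟨m, hmD⟩ q :=
    (lt_inf'_iff _).2 fun x hx => hqopt x (mem_of_mem_inter_left hx)
  refine div_le_div_of_nonneg_left (Nat.cast_nonneg _)
    (mul_pos (Nat.cast_pos.2 (card_pos.2 ⟨m, hmN⟩)) hmin) ?_
  calc (N.card : ℝ) * D.inf' ⟨m, hmD⟩ q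
      = N.card • D.inf' ⟨m, hmD⟩ q := (nsmul_eq_mul _ _).symm
    _ ≤ ∑ x ∈ N, q x := card_nsmul_le_sum _ _ _ fun x hx => inf'_le q (hND hx)
    _ ≤ ∑ x ∈ Copt l \ greedyU Cg (i - 1), q x :=
        sum_le_sum_of_subset_of_nonneg
          (sdiff_subset_sdiff (inter_subset_left.trans inter_subset_left) Subset.rfl)
          fun x hx _ => (hqopt x (mem_sdiff.1 hx).1).le
    _ ≤ ∑ x ∈ Cg i \ greedyU Cg (i - 1), q x :=
        hgreedy i hi1 hiL _ (hCoptF l hl1 hlL)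
end
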